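/- arXiv:1801.09046 — 7 statements merged into one kernel-verified Lean document; each statement's English description precedes it below -/
import Mathlib

section
/- Let v be an additive valuation on a finite set of goods, shared identically by n agents, with v(j) > 0 for every good j. Suppose A = (A_1,…,A_n) is an EFx allocation of some subset of the goods, j is an unallocated good whose value satisfies v(j) ≤ v(j') for every good j' already allocated in A, and i is an agent with v(A_i) ≤ v(A_k) for all agents k. Then the allocation obtained from A by replacing A_i with A_i ∪ {j} is again EFx. -/
open Finset

/-- If `A` is an EFx allocation (of some subset of the goods) under
identical additive valuations `v` with all goods positively valued, `j` is an
unallocated good whose value is at most that of every allocated good, and `i` is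
an agent of minimum bundle value, then adding `j` to `A i` keeps the allocation EFx. -/
theorem efx_preserved_by_greedy_step {n m : ℕ} (v : Fin m → ℝ)
    (hv : ∀ j : Fin m, 0 < v j)
    (A : Fin n → Finset (Fin m))
    (hdisj : ∀ k l : Fin n, k ≠ l → Disjoint (A k) (A l))
    (hEFx : ∀ i k : Fin n, ∀ j ∈ A k, 0 < v j →
      ∑ g ∈ A k \ {j}, v g ≤ ∑ g ∈ A i, v g)
    (j : Fin m) (hjfree : ∀ k : Fin n, j ∉ A k)
    (hjmin : ∀ k : Fin n, ∀ j' ∈ A k, v j ≤ v j')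
    (i : Fin n) (hi : ∀ k : Fin n, ∑ g ∈ A i, v g ≤ ∑ g ∈ A k, v g) :
    ∀ i' k : Fin n, ∀ g ∈ Function.update A i (insert j (A i)) k, 0 < v g →
      ∑ g' ∈ Function.update A i (insert j (A i)) k \ {g}, v g' ≤
        ∑ g' ∈ Function.update A i (insert j (A i)) i', v g' := by
  have update_ge (l : Fin n) :
      ∑ g ∈ A l, v g ≤ ∑ g ∈ Function.update A i (insert j (A i)) l, v g := by
    rcases eq_or_ne l i with rfl | hl
    · rw [Function.update_self, sum_insert (hjfree l)]
      linarith [hv j]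
    · rw [Function.update_of_ne hl]
  intro i' k g hg hvg
  refine le_trans ?_ (update_ge i')
  rcases eq_or_ne k i with rfl | hk
  · rw [Function.update_self] at hg ⊢
    have hjg : v j ≤ v g := by
      rcases mem_insert.mp hg with rfl | hg
      · exact le_rfl
      · exact hjmin k g hg
    have hsum := sum_sdiff (f := v) (singleton_subset_iff.mpr hg)
    rw [sum_singleton, sum_insert (hjfree k)] at hsum
    linarith [hi i']
  · rw [Function.update_of_ne hk] at hg ⊢
    exact hEFx i' k g hg hvg
end

section
/- Let v be an additive valuation on m goods, shared identically by n agents, with v(j) > 0 for every good j. Consider the greedy procedure that processes the goods in nonincreasing order of value and assigns each good to an agent whose current bundle has minimum value (ties broken arbitrarily). The allocation produced by this procedure is EFx. -/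
open Finset

/-- The greedy algorithm for identical additive valuations, which
processes the goods in nonincreasing order of value (`order` enumerates the goods
so that values are nonincreasing) and assigns each good to an agent whose current
bundle has minimum value (`assign`, with arbitrary tie-breaking), produces an EFx
allocation.  Here `B ℓ k` is the bundle of agent `k` after the first `ℓ` goods
have been allocated, so `B m` is the final allocation. -/
theorem greedy_identical_is_efx {n m : ℕ} (hn : 0 < n) (v : Fin m → ℝ)
    (hv : ∀ j : Fin m, 0 < v j)
    (order : Fin m ≃ Fin m)
    (hord : ∀ s t : Fin m, s ≤ t → v (order t) ≤ v (order s))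
    (assign : Fin m → Fin n)
    (B : ℕ → Fin n → Finset (Fin m))
    (hB : ∀ (ℓ : ℕ) (k : Fin n),
      B ℓ k = (Finset.univ.filter fun t : Fin m => (t : ℕ) < ℓ ∧ assign t = k).image
        (fun t => order t))
    (hgreedy : ∀ t : Fin m, ∀ k : Fin n,
      ∑ g ∈ B (t : ℕ) (assign t), v g ≤ ∑ g ∈ B (t : ℕ) k, v g) :
    ∀ i k : Fin n, ∀ j ∈ B m k, 0 < v j →
      ∑ g ∈ B m k \ {j}, v g ≤ ∑ g ∈ B m i, v g := by
  intro i k j hj _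
  have mem_B : ∀ (ℓ : ℕ) (k : Fin n) (t : Fin m),
      order t ∈ B ℓ k ↔ (t : ℕ) < ℓ ∧ assign t = k := by
    intro ℓ k t
    simp [hB]
  obtain ⟨s, rfl⟩ := order.surjective j
  have hs : assign s = k := ((mem_B m k s).1 hj).2
  -- `t` is the last step at which agent `k` receives a good.
  obtain ⟨t, ht, hmax⟩ := (univ.filter fun t => assign t = k).exists_max_image id
    ⟨s, by simp [hs]⟩
  simp only [mem_filter, mem_univ, true_and, id] at ht hmax
  have hBt : B m k = insert (order t) (B t k) := by
    ext g
    obtain ⟨u, rfl⟩ := order.surjective g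
    simp only [mem_insert, mem_B, EmbeddingLike.apply_eq_iff_eq, u.isLt, true_and]
    constructor
    · intro hu
      rcases (hmax u hu).eq_or_lt with h | h
      · exact Or.inl h
      · exact Or.inr ⟨h, hu⟩
    · rintro (rfl | ⟨_, hu⟩)
      · exact ht
      · exact hu
  have hnot : order t ∉ B t k := by simp [mem_B]
  have hmono : ∑ g ∈ B t i, v g ≤ ∑ g ∈ B m i, v g := by
    refine sum_le_sum_of_subset_of_nonneg (fun g hg => ?_) fun g _ _ => (hv g).le
    obtain ⟨u, rfl⟩ := order.surjective g
    exact (mem_B m i u).2 ⟨u.isLt, ((mem_B t i u).1 hg).2⟩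
  have hsdiff := sum_sdiff (f := v) (singleton_subset_iff.2 hj)
  have hsum : ∑ g ∈ B m k, v g = v (order t) + ∑ g ∈ B t k, v g := by
    rw [hBt, sum_insert hnot]
  have hle := hgreedy t i
  rw [sum_singleton] at hsdiff
  rw [ht] at hle
  linarith [hord s t (hmax s hs)]
end

section
/- For every fair division instance with additive and identical valuations (every good having positive value), there exists an EFx allocation of the goods among the agents. -/
open Finset

/-- The value of agent `l`'s bundle after reassigning the good `j` to agent `i`. -/
lemma sum_filter_update {ι κ : Type*} [Fintype ι] [DecidableEq ι] [DecidableEq κ]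
    (v : ι → ℝ) (f : ι → κ) (j : ι) (i l : κ) :
    ∑ g with Function.update f j i g = l, v g =
      ∑ g with f g = l, v g + ((if l = i then v j else 0) - (if l = f j then v j else 0)) := by
  simp only [sum_filter]
  rw [← sub_eq_iff_eq_add', ← sum_sub_distrib, sum_eq_single j]
  · simp [eq_comm]
  · intro g _ hg
    simp [Function.update_of_ne hg]
  · simp

/-- The sum of the squared bundle values after reassigning the good `j` to another agent `i`. -/
lemma sum_sq_update {ι κ : Type*} [Fintype ι] [DecidableEq ι] [Fintype κ] [DecidableEq κ]
    (v : ι → ℝ) (f : ι → κ) (j : ι) (i : κ) (hi : i ≠ f j) :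
    ∑ l, (∑ g with Function.update f j i g = l, v g) ^ 2 =
      ∑ l, (∑ g with f g = l, v g) ^ 2 +
        2 * v j * (∑ g with f g = i, v g - (∑ g with f g = f j, v g - v j)) := by
  simp only [sum_filter_update]
  have key : ∀ l, (∑ g with f g = l, v g +
        ((if l = i then v j else 0) - (if l = f j then v j else 0))) ^ 2 =
      (∑ g with f g = l, v g) ^ 2 +
        ((if l = i then 2 * v j * ∑ g with f g = l, v g + v j ^ 2 else 0) +
        (if l = f j then v j ^ 2 - 2 * v j * ∑ g with f g = l, v g else 0)) := by
    intro l
    by_cases h₁ : l = i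
    · subst h₁
      simp only [if_true, if_neg hi]
      ring
    · simp only [if_neg h₁]
      split_ifs <;> ring
  simp only [key, sum_add_distrib, sum_ite_eq', mem_univ, if_true]
  ring

/-- For every fair division instance with additive and identical
valuations (every good having positive value), there exists an EFx allocation:
a partition of the goods into `n` bundles such that for every pair of agents
`i, k` and every positively valued good `j ∈ A k`,
`v(A i) ≥ v(A k \ {j})`. -/
theorem exists_efx_identical {n m : ℕ} (hn : 0 < n) (v : Fin m → ℝ)
    (hv : ∀ j : Fin m, 0 < v j) :
    ∃ A : Fin n → Finset (Fin m),
      (∀ k l : Fin n, k ≠ l → Disjoint (A k) (A l)) ∧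
      (∀ j : Fin m, ∃ k : Fin n, j ∈ A k) ∧
      (∀ i k : Fin n, ∀ j ∈ A k, 0 < v j →
        ∑ g ∈ A k \ {j}, v g ≤ ∑ g ∈ A i, v g) := by
  have : Nonempty (Fin n) := ⟨⟨0, hn⟩⟩
  obtain ⟨f, hf⟩ := Finite.exists_min
    fun f : Fin m → Fin n => ∑ l, (∑ g with f g = l, v g) ^ 2
  refine ⟨fun k => univ.filter (f · = k), fun k l hkl => ?_, fun j => ⟨f j, by simp⟩, ?_⟩
  · exact disjoint_filter.2 fun g _ hk hl => hkl (hk.symm.trans hl)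
  · intro i k j hj hpos
    obtain rfl : f j = k := by simpa using hj
    by_cases hi : i = f j
    · subst hi
      exact sum_le_sum_of_subset_of_nonneg sdiff_subset fun g _ _ => (hv g).le
    · have hmin := hf (Function.update f j i)
      simp only [sum_sq_update v f j i hi, le_add_iff_nonneg_right] at hmin
      have hle := nonneg_of_mul_nonneg_right hmin (by positivity)
      have hsum := sum_sdiff_eq_sub (f := v) (singleton_subset_iff.2 hj)
      rw [sum_singleton] at hsum
      linarith
end

section
/- Let I be a fair division instance with additive and identical valuations in which every good has positive value, let A be an EFx allocation for I, and let A* be a Nash optimal allocation for I. Then NSW(A) ≥ ((e·ln 2)/2) · NSW(A*), i.e., every EFx allocation is a 1.061-approximation to the maximum Nash social welfare. -/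
open Finset

/-- The Nash social welfare of an allocation `A` under identical additive
valuations `v`: the geometric mean of the bundle values. -/
noncomputable def NSW {n m : ℕ} (v : Fin m → ℝ) (A : Fin n → Finset (Fin m)) : ℝ :=
  (∏ i : Fin n, ∑ g ∈ A i, v g) ^ ((n : ℝ)⁻¹)

/-- A potential on goods of normalized value `w`: goods of value above `β` are charged `e * w`,
the others `exp w`. -/
noncomputable def goodPotential (β w : ℝ) : ℝ :=
  if β < w then Real.exp 1 * w else Real.exp w

lemma exp_one_mul_sum_add_le_prod_goodPotential {ι : Type*} {β : ℝ} (hβ : 1 ≤ β) (w : ι → ℝ)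
    (hw : ∀ j, 0 ≤ w j) (B : Finset ι) {t : ℝ} (ht : 0 ≤ t) :
    Real.exp 1 * (∑ g ∈ B, w g + t) ≤ (∏ g ∈ B, goodPotential β (w g)) * Real.exp t := by
  classical
  induction B using Finset.induction_on generalizing t with
  | empty => simpa using Real.exp_one_mul_le_exp
  | insert a s ha ih =>
    rw [Finset.sum_insert ha, Finset.prod_insert ha]
    have hW : 0 ≤ ∑ g ∈ s, w g := Finset.sum_nonneg fun g _ => hw g
    by_cases h : β < w a
    · have h1 := ih (t := 1 + t) (by linarith)
      have h2 : Real.exp 1 * (w a + ∑ g ∈ s, w g + t) ≤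
          Real.exp 1 * (w a * (∑ g ∈ s, w g + (1 + t))) := by
        refine mul_le_mul_of_nonneg_left ?_ (Real.exp_pos 1).le
        nlinarith [mul_nonneg (by linarith : 0 ≤ w a - 1) (add_nonneg hW ht)]
      have h3 := mul_le_mul_of_nonneg_left h1 (hw a)
      rw [Real.exp_add] at h3
      simp only [goodPotential, if_pos h] at h2 h3 ⊢
      linarith
    · have h1 := ih (t := w a + t) (by linarith [hw a])
      rw [Real.exp_add] at h1
      rw [goodPotential, if_neg h]
      linarith

lemma exp_mul_log_two_le {u : ℝ} (h1 : 1 ≤ u) (h2 : u ≤ 2) :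
    Real.exp (u * Real.log 2) ≤ 2 * u := by
  have h := rpow_one_add_le_one_add_mul_self (s := 1) (by norm_num) (p := u - 1)
    (by linarith) (by linarith)
  have h' : Real.exp (u * Real.log 2) = 2 * (1 + 1 : ℝ) ^ (u - 1) := by
    rw [one_add_one_eq_two, Real.rpow_def_of_pos two_pos, ← Real.exp_log (two_pos (α := ℝ)),
      Real.log_exp, ← Real.exp_add]
    ring_nf
  rw [h']
  linarith

lemma exp_one_mul_log_two_div_two_le_one : Real.exp 1 * Real.log 2 / 2 ≤ 1 := by
  have h := Real.exp_one_mul_le_exp (x := Real.log 2)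
  rw [Real.exp_log two_pos] at h
  linarith

lemma sum_le_two_mul_of_one_lt_card {ι : Type*} [DecidableEq ι] {v : ι → ℝ}
    (hv : ∀ j, 0 < v j) {B : Finset ι} (hB : 1 < B.card) {l : ℝ}
    (h : ∀ j ∈ B, ∑ g ∈ B \ {j}, v g ≤ l) : ∑ g ∈ B, v g ≤ 2 * l := by
  obtain ⟨a, ha, b, hb, hab⟩ := Finset.one_lt_card.mp hB
  have h1 := h a ha
  have h2 := h b hb
  have e1 : ∑ g ∈ B \ {a}, v g + v a = ∑ g ∈ B, v g := by
    simpa using Finset.sum_sdiff (f := v) (Finset.singleton_subset_iff.mpr ha)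
  have e2 : v a ≤ ∑ g ∈ B \ {b}, v g :=
    Finset.single_le_sum (fun g _ => (hv g).le) (by simp [ha, hab])
  linarith

lemma prod_prod_eq_prod_of_partition {ι κ : Type*} [Fintype ι] [Fintype κ]
    (A : κ → Finset ι) (hdisj : ∀ k l, k ≠ l → Disjoint (A k) (A l))
    (hcov : ∀ j, ∃ k, j ∈ A k) (f : ι → ℝ) : ∏ k, ∏ g ∈ A k, f g = ∏ g, f g := by
  classical
  rw [← Finset.prod_biUnion fun k _ l _ hkl => hdisj k l hkl]
  congr 1
  ext j
  simpa using hcov j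

lemma exists_eq_empty_of_card_lt {ι κ : Type*} [Fintype ι] [Fintype κ]
    (hcard : Fintype.card ι < Fintype.card κ)
    (B : κ → Finset ι) (hdisj : ∀ k l, k ≠ l → Disjoint (B k) (B l)) : ∃ k, B k = ∅ := by
  classical
  by_contra! hne
  choose f hf using hne
  have hinj : Function.Injective f := by
    intro k l hkl
    by_contra hne'
    exact Finset.disjoint_left.mp (hdisj k l hne') (hf k) (hkl ▸ hf l)
  exact absurd (Fintype.card_le_of_injective f hinj) (by omega)

lemma card_lt_of_efx_of_eq_empty {n m : ℕ} {v : Fin m → ℝ} (hv : ∀ j, 0 < v j)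
    {A : Fin n → Finset (Fin m)} (hcov : ∀ j, ∃ k, j ∈ A k)
    (hEFx : ∀ i k : Fin n, ∀ j ∈ A k, 0 < v j → ∑ g ∈ A k \ {j}, v g ≤ ∑ g ∈ A i, v g)
    {i : Fin n} (hi : A i = ∅) : m < n := by
  choose f hf using hcov
  have hinj : Function.Injective f := by
    intro a b hab
    by_contra hne
    have h1 := hEFx i (f a) a (hf a) (hv a)
    have hb : v b ≤ ∑ g ∈ A (f a) \ {a}, v g :=
      Finset.single_le_sum (fun g _ => (hv g).le) (by simp [hab, hf b, Ne.symm hne])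
    rw [hi, Finset.sum_empty] at h1
    linarith [hv b]
  have h := Fintype.card_lt_of_injective_of_notMem f hinj (b := i) (by
    rintro ⟨a, rfl⟩
    simpa [hi] using hf a)
  simpa using h

/-- In an EFx bundle, given the least bundle value `l`, the product of the potentials is at most
the normalized bundle value up to the approximation factor. -/
lemma prod_goodPotential_le {ι : Type*} [DecidableEq ι] {v : ι → ℝ} (hv : ∀ j, 0 < v j)
    {B : Finset ι} {l : ℝ} (hl : 0 < l) (hlB : l ≤ ∑ g ∈ B, v g)
    (h : ∀ j ∈ B, ∑ g ∈ B \ {j}, v g ≤ l) :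
    Real.exp 1 * Real.log 2 / 2 *
        ∏ g ∈ B, goodPotential (2 * Real.log 2) (v g / l * Real.log 2) ≤
      Real.exp 1 * ((∑ g ∈ B, v g) / l * Real.log 2) := by
  have hlog : 0 < Real.log 2 := Real.log_pos one_lt_two
  have he := Real.exp_pos 1
  by_cases hB : ∑ g ∈ B, v g ≤ 2 * l
  · have hsmall : ∀ g ∈ B, goodPotential (2 * Real.log 2) (v g / l * Real.log 2) =
        Real.exp (v g / l * Real.log 2) := by
      intro g hg
      have : v g ≤ 2 * l := (Finset.single_le_sum (fun g _ => (hv g).le) hg).trans hB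
      rw [goodPotential, if_neg]
      exact not_lt.mpr (mul_le_mul_of_nonneg_right ((div_le_iff₀ hl).mpr this) hlog.le)
    rw [Finset.prod_congr rfl hsmall, ← Real.exp_sum, ← Finset.sum_mul, ← Finset.sum_div]
    have h2 := exp_mul_log_two_le ((one_le_div₀ hl).mpr hlB) ((div_le_iff₀ hl).mpr hB)
    have h3 := mul_le_mul_of_nonneg_left h2
      (by positivity : 0 ≤ Real.exp 1 * Real.log 2 / 2)
    linarith
  · have hcard : B.card = 1 := by
      have h1 : ¬ 1 < B.card := fun hc => hB (sum_le_two_mul_of_one_lt_card hv hc h)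
      have h2 : B.card ≠ 0 := by
        rw [Ne, Finset.card_eq_zero]
        rintro rfl
        simp at hlB
        linarith
      omega
    obtain ⟨g, rfl⟩ := Finset.card_eq_one.mp hcard
    simp only [Finset.sum_singleton, Finset.prod_singleton] at hB ⊢
    rw [goodPotential, if_pos
      (mul_lt_mul_of_pos_right ((lt_div_iff₀ hl).mpr (not_le.mp hB)) hlog)]
    have := hv g
    exact mul_le_of_le_one_left (by positivity) exp_one_mul_log_two_div_two_le_one

/-- Under additive identical valuations with all goods positively
valued, every EFx allocation `A` satisfies `NSW(A) ≥ ((e·ln 2)/2) · NSW(A*)`,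
where `A*` is a Nash optimal allocation. -/
theorem efx_approximates_nash {n m : ℕ} (hn : 0 < n) (v : Fin m → ℝ)
    (hv : ∀ j : Fin m, 0 < v j)
    (A Astar : Fin n → Finset (Fin m))
    (hAdisj : ∀ k l : Fin n, k ≠ l → Disjoint (A k) (A l))
    (hAcov : ∀ j : Fin m, ∃ k : Fin n, j ∈ A k)
    (hSdisj : ∀ k l : Fin n, k ≠ l → Disjoint (Astar k) (Astar l))
    (hScov : ∀ j : Fin m, ∃ k : Fin n, j ∈ Astar k)
    (hEFx : ∀ i k : Fin n, ∀ j ∈ A k, 0 < v j →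
      ∑ g ∈ A k \ {j}, v g ≤ ∑ g ∈ A i, v g)
    (hopt : ∀ B : Fin n → Finset (Fin m),
      (∀ k l : Fin n, k ≠ l → Disjoint (B k) (B l)) →
      (∀ j : Fin m, ∃ k : Fin n, j ∈ B k) →
      NSW v B ≤ NSW v Astar) :
    Real.exp 1 * Real.log 2 / 2 * NSW v Astar ≤ NSW v A := by
  have he := Real.exp_pos 1
  have hlog : 0 < Real.log 2 := Real.log_pos one_lt_two
  have hc : 0 ≤ Real.exp 1 * Real.log 2 / 2 := by positivity
  have hnn : ∀ B : Fin n → Finset (Fin m), ∀ i, 0 ≤ ∑ g ∈ B i, v g :=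
    fun B i => Finset.sum_nonneg fun g _ => (hv g).le
  have hn' : n ≠ 0 := hn.ne'
  by_cases hE : ∃ i, A i = ∅
  · obtain ⟨i, hi⟩ := hE
    obtain ⟨k, hk⟩ := exists_eq_empty_of_card_lt
      (by simpa using card_lt_of_efx_of_eq_empty hv hAcov hEFx hi) Astar hSdisj
    have h0 : NSW v Astar = 0 := by
      rw [NSW, Finset.prod_eq_zero (Finset.mem_univ k) (by simp [hk]), Real.zero_rpow]
      simpa using hn'
    rw [h0, mul_zero]
    exact Real.rpow_nonneg (Finset.prod_nonneg fun i _ => hnn A i) _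
  push Not at hE
  have : Nonempty (Fin n) := ⟨⟨0, hn⟩⟩
  obtain ⟨i₀, hi₀⟩ := Finite.exists_min fun i => ∑ g ∈ A i, v g
  set l := ∑ g ∈ A i₀, v g
  have hl : 0 < l := Finset.sum_pos (fun g _ => hv g) (hE i₀)
  set φ : Fin m → ℝ := fun g => goodPotential (2 * Real.log 2) (v g / l * Real.log 2)
  have hβ : 1 ≤ 2 * Real.log 2 := by linarith [Real.log_two_gt_d9]
  have hstar : ∀ i, Real.exp 1 * ((∑ g ∈ Astar i, v g) / l * Real.log 2) ≤
      ∏ g ∈ Astar i, φ g := by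
    intro i
    have h := exp_one_mul_sum_add_le_prod_goodPotential hβ (fun g => v g / l * Real.log 2)
      (fun g => by have := hv g; positivity) (Astar i) le_rfl
    simpa only [add_zero, Real.exp_zero, mul_one, ← Finset.sum_mul, ← Finset.sum_div] using h
  have hA : ∀ i, Real.exp 1 * Real.log 2 / 2 * ∏ g ∈ A i, φ g ≤
      Real.exp 1 * ((∑ g ∈ A i, v g) / l * Real.log 2) := fun i =>
    prod_goodPotential_le hv hl (hi₀ i) fun j hj => hEFx i₀ i j hj (hv j)
  have hφ : ∀ g, 0 ≤ φ g := by
    intro g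
    have := hv g
    simp only [φ, goodPotential]
    split_ifs <;> positivity
  have hpull : ∀ B : Fin n → Finset (Fin m),
      ∏ i, Real.exp 1 * ((∑ g ∈ B i, v g) / l * Real.log 2) =
        (Real.exp 1 * Real.log 2 / l) ^ n * ∏ i, ∑ g ∈ B i, v g := by
    intro B
    have : ∀ i, Real.exp 1 * ((∑ g ∈ B i, v g) / l * Real.log 2) =
        (Real.exp 1 * Real.log 2 / l) * ∑ g ∈ B i, v g := fun i => by ring
    rw [Finset.prod_congr rfl fun i _ => this i, Finset.prod_mul_distrib, Finset.prod_const,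
      Finset.card_univ, Fintype.card_fin]
  have hprod : (Real.exp 1 * Real.log 2 / 2) ^ n * ∏ i, ∑ g ∈ Astar i, v g ≤
      ∏ i, ∑ g ∈ A i, v g := by
    have h1 : ∏ i, Real.exp 1 * ((∑ g ∈ Astar i, v g) / l * Real.log 2) ≤ ∏ g, φ g := by
      rw [← prod_prod_eq_prod_of_partition Astar hSdisj hScov]
      refine Finset.prod_le_prod (fun i _ => ?_) fun i _ => hstar i
      have := hnn Astar i
      positivity
    have h2 : (Real.exp 1 * Real.log 2 / 2) ^ n * ∏ g, φ g ≤
        ∏ i, Real.exp 1 * ((∑ g ∈ A i, v g) / l * Real.log 2) := by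
      rw [← prod_prod_eq_prod_of_partition A hAdisj hAcov]
      have h3 := Finset.prod_le_prod (s := Finset.univ)
        (fun i _ => mul_nonneg hc (Finset.prod_nonneg fun g (_ : g ∈ A i) => hφ g))
        fun i _ => hA i
      rwa [Finset.prod_mul_distrib, Finset.prod_const, Finset.card_univ, Fintype.card_fin] at h3
    rw [hpull] at h1 h2
    have hK : 0 < (Real.exp 1 * Real.log 2 / l) ^ n := by positivity
    refine le_of_mul_le_mul_left ?_ hK
    have h4 := mul_le_mul_of_nonneg_left h1 (pow_nonneg hc n)
    linarith
  have hroot := Real.rpow_le_rpow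
    (mul_nonneg (pow_nonneg hc n) (Finset.prod_nonneg fun i _ => hnn Astar i)) hprod
    (by positivity : 0 ≤ (n : ℝ)⁻¹)
  rwa [Real.mul_rpow (pow_nonneg hc n) (Finset.prod_nonneg fun i _ => hnn Astar i),
    Real.pow_rpow_inv_natCast hc hn'] at hroot
end

section
/- For every real number α > 0, one has 2^(α−1)/α ≥ (e·ln 2)/2, with equality when α = 1/ln 2. -/
/-- For every real `α > 0` we have `2^(α−1)/α ≥ (e·ln 2)/2`
(real powers), with equality when `α = 1/ln 2`. -/
theorem two_rpow_div_ge_e_log_two_div_two :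
    (∀ α : ℝ, 0 < α → Real.exp 1 * Real.log 2 / 2 ≤ (2 : ℝ) ^ (α - 1) / α) ∧
    (2 : ℝ) ^ ((Real.log 2)⁻¹ - 1) / (Real.log 2)⁻¹ = Real.exp 1 * Real.log 2 / 2 := by
  have two_rpow_sub_one (α : ℝ) : (2 : ℝ) ^ (α - 1) = Real.exp (Real.log 2 * α) / 2 := by
    rw [Real.rpow_sub_one two_ne_zero, Real.rpow_def_of_pos two_pos]
  have hlog : Real.log 2 ≠ 0 := (Real.log_pos one_lt_two).ne'
  refine ⟨fun α hα => ?_, ?_⟩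
  · have key : Real.exp 1 * (Real.log 2 * α) ≤ Real.exp (Real.log 2 * α) := by
      calc Real.exp 1 * (Real.log 2 * α)
          ≤ Real.exp 1 * Real.exp (Real.log 2 * α - 1) := by
            gcongr
            linarith [Real.add_one_le_exp (Real.log 2 * α - 1)]
        _ = Real.exp (Real.log 2 * α) := by rw [← Real.exp_add, add_sub_cancel]
    rw [two_rpow_sub_one, le_div_iff₀ hα]
    linarith
  · rw [two_rpow_sub_one, mul_inv_cancel₀ hlog, div_inv_eq_mul]
    ring
end

section
/- Consider the fair division instance with n = 2 agents and m = 6 goods, where the agents have identical additive valuations given by v(j_1) = v(j_2) = 4 and v(j_3) = v(j_4) = v(j_5) = v(j_6) = 1. The allocation A = ({j_1, j_2}, {j_3, j_4, j_5, j_6}) is EFx, the Nash optimal value is NSW(A*) = 6, and NSW(A) = (2√2/3)·NSW(A*). -/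
open Finset

/-- The identical valuation of the tight example: goods `j₁, j₂` have value `4`
and goods `j₃, …, j₆` have value `1`. -/
noncomputable def vEx : Fin 6 → ℝ := fun j => if (j : ℕ) < 2 then 4 else 1

/-- The allocation `A = ({j₁, j₂}, {j₃, j₄, j₅, j₆})` of the tight example. -/
def AEx : Fin 2 → Finset (Fin 6) := ![{0, 1}, {2, 3, 4, 5}]

lemma NSW_two {m : ℕ} (v : Fin m → ℝ) (A : Fin 2 → Finset (Fin m)) :
    NSW v A = √((∑ g ∈ A 0, v g) * ∑ g ∈ A 1, v g) := by
  simp [NSW, Fin.prod_univ_two, Real.sqrt_eq_rpow]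

/-- The Nash social welfare of two agents is at most half of the total value. -/
lemma NSW_two_le {m : ℕ} {v : Fin m → ℝ} (hv : 0 ≤ ∑ g, v g) {A : Fin 2 → Finset (Fin m)}
    (hdisj : Disjoint (A 0) (A 1)) (hcover : A 0 ∪ A 1 = univ) :
    NSW v A ≤ (∑ g, v g) / 2 := by
  have hsum : ∑ g ∈ A 0, v g + ∑ g ∈ A 1, v g = ∑ g, v g := by
    rw [← sum_union hdisj, hcover]
  rw [NSW_two, ← hsum]
  refine Real.sqrt_le_iff.mpr ⟨by linarith, ?_⟩
  nlinarith [sq_nonneg (∑ g ∈ A 0, v g - ∑ g ∈ A 1, v g)]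

lemma sum_vEx : ∑ g, vEx g = 12 := by
  norm_num [vEx, Fin.sum_univ_succ]

lemma sum_vEx_AEx_zero : ∑ g ∈ AEx 0, vEx g = 8 := by
  norm_num [vEx, AEx]

lemma sum_vEx_AEx_one : ∑ g ∈ AEx 1, vEx g = 4 := by
  have h : AEx 1 = {2, 3, 4, 5} := rfl
  rw [h]
  simp [vEx]
  norm_num

/-- In the instance with `n = 2` agents and `m = 6` goods, identical
additive valuations `v(j₁) = v(j₂) = 4`, `v(j₃) = ⋯ = v(j₆) = 1`, the allocation
`A = ({j₁, j₂}, {j₃, j₄, j₅, j₆})` is EFx, the Nash optimal value is `6`, and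
`NSW(A) = (2√2/3)·6`. -/
theorem tight_example_for_efx :
    (∀ i k : Fin 2, ∀ j ∈ AEx k, 0 < vEx j →
      ∑ g ∈ AEx k \ {j}, vEx g ≤ ∑ g ∈ AEx i, vEx g) ∧
    IsGreatest {x : ℝ | ∃ B : Fin 2 → Finset (Fin 6),
      (∀ k l : Fin 2, k ≠ l → Disjoint (B k) (B l)) ∧
      (∀ j : Fin 6, ∃ k : Fin 2, j ∈ B k) ∧ NSW vEx B = x} 6 ∧
    NSW vEx AEx = (2 * Real.sqrt 2 / 3) * 6 := by
  refine ⟨?_, ⟨?_, ?_⟩, ?_⟩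
  · intro i k j hj _
    have hi : 4 ≤ ∑ g ∈ AEx i, vEx g := by
      fin_cases i
      · exact (by norm_num : (4 : ℝ) ≤ 8).trans sum_vEx_AEx_zero.ge
      · exact sum_vEx_AEx_one.ge
    refine le_trans ?_ hi
    have hdel := sum_sdiff (f := vEx) (singleton_subset_iff.mpr hj)
    rw [sum_singleton] at hdel
    fin_cases k
    · have hvj : vEx j = 4 := by
        have : j = 0 ∨ j = 1 := by simpa [AEx] using hj
        rcases this with rfl | rfl <;> simp [vEx]
      have := sum_vEx_AEx_zero
      simp only [Fin.zero_eta] at hdel ⊢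
      linarith
    · have hvj : 0 ≤ vEx j := by
        unfold vEx
        split_ifs <;> norm_num
      have := sum_vEx_AEx_one
      simp only [Fin.mk_one] at hdel ⊢
      linarith
  · refine ⟨![{0, 2, 3}, {1, 4, 5}], by decide, by decide, ?_⟩
    rw [NSW_two, Real.sqrt_eq_iff_mul_self_eq_of_pos (by norm_num)]
    simp [vEx]
    norm_num
  · rintro x ⟨B, hdisj, hcover, rfl⟩
    have hunion : B 0 ∪ B 1 = univ := by
      ext j
      simpa [Fin.exists_fin_two] using hcover j
    have := NSW_two_le (v := vEx) (by norm_num [sum_vEx]) (hdisj 0 1 (by decide)) hunion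
    rw [sum_vEx] at this
    linarith
  · rw [NSW_two, sum_vEx_AEx_zero, sum_vEx_AEx_one,
      Real.sqrt_eq_iff_mul_self_eq_of_pos (by positivity)]
    nlinarith [Real.mul_self_sqrt (show (0 : ℝ) ≤ 2 by norm_num)]
end

section
/- Let there be n agents and m goods, where each agent i has a set Γ_i of approved goods and a valuation of the form v_i(S) = f_i(|S ∩ Γ_i|) for a nondecreasing concave function f_i : ℕ → ℝ with f_i(0) = 0 (concavity meaning f_i(k+1) − f_i(k) ≤ f_i(k) − f_i(k−1) for all k ≥ 1). Let A be an allocation assigning to each agent i only goods from Γ_i, with v_i(A_i) > 0 for all i. Suppose that for every pair of agents u ≠ v such that v is reachable from u in the directed graph G(A) (which has an edge from a to b whenever some good j ∈ A_a lies in Γ_b), one has f_u(|A_u| − 1)·f_v(|A_v| + 1) ≤ f_u(|A_u|)·f_v(|A_v|). Then A maximizes the Nash social welfare NSW(B) = (∏_i v_i(B_i))^{1/n} over all allocations B. -/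
open Finset

/-- Growth of a concave nondecreasing sequence to the right of `a` is at most geometric,
with any ratio that bounds the first step. -/
theorem succ_le_mul_of_concave {f : ℕ → ℝ} (hmono : Monotone f)
    (hconc : ∀ k, 1 ≤ k → f (k + 1) - f k ≤ f k - f (k - 1)) {c : ℝ} (hc : 1 ≤ c) {a : ℕ}
    (hup : f (a + 1) ≤ c * f a) (d : ℕ) : f (a + d + 1) ≤ c * f (a + d) := by
  have hstep : f (a + d + 1) - f (a + d) ≤ f (a + 1) - f a := by
    induction d with
    | zero => simp
    | succ d ih =>
      have h := hconc (a + (d + 1)) (by omega)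
      have e : a + (d + 1) - 1 = a + d := by omega
      rw [e] at h
      exact h.trans ih
  nlinarith [hmono (show a ≤ a + d by omega)]

/-- If the last step up to `a` has ratio at least `c`, then so does every earlier step. -/
theorem mul_le_succ_of_concave {f : ℕ → ℝ} (hmono : Monotone f)
    (hconc : ∀ k, 1 ≤ k → f (k + 1) - f k ≤ f k - f (k - 1)) {c : ℝ} (hc : 1 ≤ c) {a : ℕ}
    (hdown : c * f (a - 1) ≤ f a) {k : ℕ} (hk : k < a) : c * f k ≤ f (k + 1) := by
  obtain ⟨b, rfl⟩ : ∃ b, a = b + 1 := ⟨a - 1, by omega⟩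
  refine Nat.decreasingInduction' (P := fun k => c * f k ≤ f (k + 1)) ?_
    (Nat.lt_succ_iff.mp hk) hdown
  intro j _ _ ih
  have h := hconc (j + 1) (by omega)
  rw [Nat.add_sub_cancel] at h
  nlinarith [hmono (Nat.le_succ j)]

/-- Multiplicative supergradient inequality for concave nondecreasing sequences. -/
theorem mul_pow_le_mul_pow_of_concave {f : ℕ → ℝ} (hmono : Monotone f)
    (hconc : ∀ k, 1 ≤ k → f (k + 1) - f k ≤ f k - f (k - 1)) {c : ℝ} (hc : 1 ≤ c) {a : ℕ}
    (hup : f (a + 1) ≤ c * f a) (hdown : c * f (a - 1) ≤ f a) (b : ℕ) :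
    f b * c ^ a ≤ f a * c ^ b := by
  have hc0 : 0 ≤ c := zero_le_one.trans hc
  rcases le_total a b with h | h
  · induction b, h using Nat.le_induction with
    | base => exact le_rfl
    | succ b hb ih =>
      obtain ⟨d, rfl⟩ := Nat.exists_eq_add_of_le hb
      calc f (a + d + 1) * c ^ a ≤ c * f (a + d) * c ^ a := by
            gcongr
            exact succ_le_mul_of_concave hmono hconc hc hup d
        _ = c * (f (a + d) * c ^ a) := by ring
        _ ≤ c * (f a * c ^ (a + d)) := by gcongr
        _ = f a * c ^ (a + d + 1) := by ring
  · refine Nat.decreasingInduction' (P := fun b => f b * c ^ a ≤ f a * c ^ b) ?_ h le_rfl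
    intro k hk _ ih
    have h1 : c * f k * c ^ a ≤ f (k + 1) * c ^ a := by
      gcongr
      exact mul_le_succ_of_concave hmono hconc hc hdown hk
    rw [pow_succ] at ih
    refine le_of_mul_le_mul_left ?_ (zero_lt_one.trans_le hc)
    linarith

/-- A product over all elements splits along a partition. -/
theorem prod_prod_of_partition {ι κ M : Type*} [Fintype ι] [Fintype κ] [CommMonoid M]
    {P : ι → Finset κ} (hdisj : ∀ k l, k ≠ l → Disjoint (P k) (P l))
    (hcov : ∀ j, ∃ k, j ∈ P k) (g : κ → M) : ∏ i, ∏ j ∈ P i, g j = ∏ j, g j := by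
  classical
  rw [← prod_biUnion fun k _ l _ hkl => hdisj k l hkl]
  congr 1
  ext j
  simpa using hcov j

/-- If prices `c ≥ 1` do not increase when a good moves from its owner in `A` to an approving
agent, then the total price of the approved goods is at most that under `A`. -/
theorem prod_pow_card_inter_le {ι κ : Type*} [Fintype ι] [Fintype κ] [DecidableEq κ]
    {Γ A B : ι → Finset κ} {c : ι → ℝ} (hc : ∀ i, 1 ≤ c i)
    (hedge : ∀ u v, (∃ j ∈ A u, j ∈ Γ v) → c v ≤ c u)
    (hAdisj : ∀ k l, k ≠ l → Disjoint (A k) (A l)) (hAcov : ∀ j, ∃ k, j ∈ A k)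
    (hBdisj : ∀ k l, k ≠ l → Disjoint (B k) (B l)) (hBcov : ∀ j, ∃ k, j ∈ B k) :
    ∏ i, c i ^ (B i ∩ Γ i).card ≤ ∏ i, c i ^ (A i).card := by
  choose owner h_owner using hAcov
  have hA : ∏ i, c i ^ (A i).card = ∏ j, c (owner j) := by
    rw [← prod_prod_of_partition hAdisj fun j => ⟨owner j, h_owner j⟩]
    refine prod_congr rfl fun i _ => ?_
    rw [← prod_const]
    refine prod_congr rfl fun j hj => congrArg c ?_
    by_contra hne
    exact disjoint_left.mp (hAdisj _ _ hne) hj (h_owner j)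
  have hc0 : ∀ i, 0 ≤ c i := fun i => zero_le_one.trans (hc i)
  rw [hA, ← prod_prod_of_partition hBdisj hBcov]
  refine prod_le_prod (fun i _ => pow_nonneg (hc0 i) _) fun i _ => ?_
  rw [← prod_const, ← prod_ite_mem]
  refine prod_le_prod (fun j _ => ?_) fun j _ => ?_
  · split_ifs
    exacts [hc0 i, zero_le_one]
  · split_ifs with hj
    exacts [hedge _ _ ⟨j, h_owner j, hj⟩, hc _]

/-- Concave-in-cardinality valuations.  Each agent `i` has an
approval set `Γ i` and valuation `v_i(S) = f i |S ∩ Γ i|` with `f i` nondecreasing,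
concave, and `f i 0 = 0`.  If `A` is an allocation with `A i ⊆ Γ i` and
`v_i(A_i) > 0` for all `i`, and `A` is locally optimal with respect to chains of
single-good swaps (for every `u ≠ v` with `v` reachable from `u` in `G(A)`,
`f u (|A u| − 1) · f v (|A v| + 1) ≤ f u |A u| · f v |A v|`), then `A` maximizes
the Nash social welfare `(∏ i, f i |B i ∩ Γ i|)^(1/n)` over all allocations `B`. -/
theorem concave_local_opt_is_global {n m : ℕ} (hn : 0 < n)
    (Γ : Fin n → Finset (Fin m)) (f : Fin n → ℕ → ℝ)
    (hf0 : ∀ i : Fin n, f i 0 = 0)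
    (hmono : ∀ i : Fin n, Monotone (f i))
    (hconc : ∀ i : Fin n, ∀ k : ℕ, 1 ≤ k → f i (k + 1) - f i k ≤ f i k - f i (k - 1))
    (A : Fin n → Finset (Fin m))
    (hAdisj : ∀ k l : Fin n, k ≠ l → Disjoint (A k) (A l))
    (hAcov : ∀ j : Fin m, ∃ k : Fin n, j ∈ A k)
    (hAsub : ∀ i : Fin n, A i ⊆ Γ i)
    (hpos : ∀ i : Fin n, 0 < f i (A i).card)
    (hloc : ∀ u v : Fin n, u ≠ v →
      Relation.ReflTransGen (fun a b : Fin n => ∃ j ∈ A a, j ∈ Γ b) u v →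
      f u ((A u).card - 1) * f v ((A v).card + 1) ≤
        f u (A u).card * f v (A v).card) :
    ∀ B : Fin n → Finset (Fin m),
      (∀ k l : Fin n, k ≠ l → Disjoint (B k) (B l)) →
      (∀ j : Fin m, ∃ k : Fin n, j ∈ B k) →
      (∏ i : Fin n, f i (B i ∩ Γ i).card) ^ ((n : ℝ)⁻¹) ≤
        (∏ i : Fin n, f i (A i ∩ Γ i).card) ^ ((n : ℝ)⁻¹) := by
  classical
  intro B hBdisj hBcov
  have hnonneg : ∀ i k, 0 ≤ f i k := fun i k => hf0 i ▸ hmono i (Nat.zero_le k)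
  refine Real.rpow_le_rpow (prod_nonneg fun i _ => hnonneg i _) ?_ (by positivity)
  simp only [inter_eq_left.mpr (hAsub _)]
  let reach := Relation.ReflTransGen fun a b : Fin n => ∃ j ∈ A a, j ∈ Γ b
  let β : Fin n → ℝ := fun v => f v ((A v).card + 1) / f v (A v).card
  have hmax : ∀ u, ∃ v, reach u v ∧ ∀ w, reach u w → β w ≤ β v := by
    intro u
    obtain ⟨v, hv, hw⟩ := exists_max_image (univ.filter (reach u)) β
      ⟨u, by simpa using Relation.ReflTransGen.refl⟩
    exact ⟨v, by simpa using hv, fun w h => hw w (by simpa using h)⟩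
  choose t ht htmax using hmax
  have hc : ∀ u, 1 ≤ β (t u) := fun u =>
    (one_le_div (hpos _)).mpr (hmono _ (Nat.le_succ _))
  have hedge : ∀ u v, (∃ j ∈ A u, j ∈ Γ v) → β (t v) ≤ β (t u) := fun u v huv =>
    htmax u _ ((Relation.ReflTransGen.single huv).trans (ht v))
  have hup : ∀ u, f u ((A u).card + 1) ≤ β (t u) * f u (A u).card := fun u =>
    (div_le_iff₀ (hpos u)).mp (htmax u u Relation.ReflTransGen.refl)
  have hdown : ∀ u, β (t u) * f u ((A u).card - 1) ≤ f u (A u).card := by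
    intro u
    have hswap : f u ((A u).card - 1) * f (t u) ((A (t u)).card + 1) ≤
        f u (A u).card * f (t u) (A (t u)).card := by
      rcases eq_or_ne u (t u) with h | h
      · rw [← h]
        have hcard : 1 ≤ (A u).card := by
          by_contra h0
          have h1 := hpos u
          rw [show (A u).card = 0 by omega, hf0] at h1
          exact h1.false
        have hk := hconc u _ hcard
        nlinarith [hnonneg u ((A u).card - 1), sq_nonneg (f u (A u).card - f u ((A u).card - 1))]
      · exact hloc u (t u) h (ht u)
    rw [div_mul_eq_mul_div, div_le_iff₀ (hpos _), mul_comm]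
    exact hswap
  have hagent := prod_le_prod
    (fun i (_ : i ∈ univ) => mul_nonneg (hnonneg i (B i ∩ Γ i).card)
      (pow_nonneg (zero_le_one.trans (hc i)) (A i).card))
    fun i _ => mul_pow_le_mul_pow_of_concave (hmono i) (hconc i) (hc i) (hup i) (hdown i)
      (B i ∩ Γ i).card
  rw [prod_mul_distrib, prod_mul_distrib] at hagent
  have hprice := prod_pow_card_inter_le hc hedge hAdisj hAcov hBdisj hBcov
  have hprice_pos : 0 < ∏ i, β (t i) ^ (A i).card :=
    prod_pos fun i _ => pow_pos (zero_lt_one.trans_le (hc i)) _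
  exact le_of_mul_le_mul_right (hagent.trans
    (mul_le_mul_of_nonneg_left hprice (prod_nonneg fun i _ => hnonneg i _))) hprice_pos
end
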